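/- arXiv:2001.06770 — 3 statements merged into one kernel-verified Lean document; each statement's English description precedes it below -/
import Mathlib

section
/- The per-edge weight upper bound is monotone: the function U : ℤ → ℝ defined by U(a) := α·(a + 1/2)/Ā for a < Round(Ā) and U(a) := 1 + (a + 1/2 − 2Ā)·(1 − α)/Ā for a ≥ Round(Ā) is (strictly) monotone increasing on the integers. -/
/-- Rounding to the nearest integer, with halves rounded up. -/
noncomputable def roundHalf (x : ℝ) : ℤ := ⌊x + 1/2⌋

/-- Edge activation level obtained by the reward-and-penalty coarsening of a
normalized fine-grained edge weight `w`, with parameters `A = Ā` and `α`. -/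
noncomputable def actLevel (A α w : ℝ) : ℤ :=
  if w ≤ α then roundHalf (A - A * (α - w) / α)
  else roundHalf (A + A * (w - α) / (1 - α))


/-- The per-edge upper bound on the normalized fine-grained weight of an edge
whose activation level is `a` (Theorem 1). -/
noncomputable def ubound (A α : ℝ) (a : ℤ) : ℝ :=
  if a < roundHalf A then α * ((a : ℝ) + 1/2) / A
  else 1 + ((a : ℝ) + 1/2 - 2 * A) * (1 - α) / A

/-- The per-edge weight upper bound `U` is strictly monotone increasing on ℤ. -/
theorem stmt9 (A α : ℝ) (hA : 0 < A) (hα0 : 0 < α) (hα1 : α < 1) :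
    StrictMono (ubound A α) := by
  refine strictMono_int_of_lt_succ fun a => ?_
  have hlo : A < roundHalf A + 1 / 2 := by
    have := Int.lt_floor_add_one (A + 1 / 2)
    unfold roundHalf
    linarith
  have hhi : (roundHalf A : ℝ) ≤ A + 1 / 2 := Int.floor_le _
  have hβ : 0 < 1 - α := sub_pos.mpr hα1
  unfold ubound
  split_ifs with h₁ h₂ h₂
  · push_cast
    gcongr
    linarith
  · have hle : (a : ℝ) + 1 ≤ roundHalf A := by exact_mod_cast h₁
    have hge : (roundHalf A : ℝ) ≤ ((a + 1 : ℤ) : ℝ) := by exact_mod_cast not_lt.mp h₂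
    have hleft : α * ((a : ℝ) + 1 / 2) / A ≤ α := by
      rw [div_le_iff₀ hA]
      gcongr
      linarith
    have hright : -(1 - α) < (((a + 1 : ℤ) : ℝ) + 1 / 2 - 2 * A) * (1 - α) / A := by
      rw [lt_div_iff₀ hA]
      nlinarith
    linarith
  · omega
  · push_cast
    gcongr
    linarith
end

section
/- Bellman equation for the coarse-grained distance: for vertices s and v with v ≠ s, D(s, v) = min over all in-edges (u, v) with activation level a_{uv} of ( max{D(s, u), a_{uv}} + 1 ), where the minimum over an empty set is ∞. In particular, a walk p from s ending with the edge (u, v) realizes D(s, v) only if D(s, v) = max{D(s, u), a_{uv}} + 1, which is the criterion used in the recovering phase. (Lemma 1.) -/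
/-- A walk in the directed graph with adjacency relation `Adj`, represented by
its (nonempty) list of vertices, consecutive vertices being joined by a
directed edge. Vertices may repeat. -/
def IsWalk {V : Type*} (Adj : V → V → Prop) (p : List V) : Prop :=
  p ≠ [] ∧ p.Chain' Adj

/-- The coarse-grained score `F(p)` of a walk `p` over a graph whose edges
carry natural-number activation levels `lvl`: `F` of a single-vertex walk
is `0`, and appending an edge with level `a` to a walk of score `s` gives
score `max s a + 1` (the fold processes the consecutive edges of `p`
in path order). -/
def wscore {V : Type*} (lvl : V → V → ℕ) (p : List V) : ℕ :=
  ((p.zip p.tail).map (fun e => lvl e.1 e.2)).foldl (fun s a => max s a + 1) 0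

/-- The coarse-grained distance `D(u, v)`: the minimum of `F(p)` over all
walks `p` from `u` to `v`, and `∞` if there is no such walk. -/
noncomputable def wdist {V : Type*} (Adj : V → V → Prop) (lvl : V → V → ℕ)
    (u v : V) : ℕ∞ :=
  sInf {n : ℕ∞ | ∃ p : List V, IsWalk Adj p ∧ p.head? = some u ∧
    p.getLast? = some v ∧ (wscore lvl p : ℕ∞) = n}

theorem zip_tail_append_pair {V : Type*} (q : List V) (u v : V) :
    (q ++ [u, v]).zip (q ++ [u, v]).tail =
      (q ++ [u]).zip (q ++ [u]).tail ++ [(u, v)] := by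
  induction q with
  | nil => rfl
  | cons a q ih => cases q <;> simp_all

/-- The recursive definition of the score by removal of the last edge. -/
theorem wscore_append_pair {V : Type*} (lvl : V → V → ℕ) (q : List V) (u v : V) :
    wscore lvl (q ++ [u, v]) = max (wscore lvl (q ++ [u])) (lvl u v) + 1 := by
  simp only [wscore, zip_tail_append_pair, List.map_append, List.foldl_append,
    List.map_cons, List.map_nil, List.foldl_cons, List.foldl_nil]

theorem isWalk_append_pair {V : Type*} {Adj : V → V → Prop} {q : List V} {u v : V} :
    IsWalk Adj (q ++ [u, v]) ↔ IsWalk Adj (q ++ [u]) ∧ Adj u v := by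
  simp [IsWalk, List.Chain', List.isChain_append_cons_cons]

theorem head?_append_pair {V : Type*} (q : List V) (u v : V) :
    (q ++ [u, v]).head? = (q ++ [u]).head? := by
  cases q <;> rfl

theorem wdist_le_wscore {V : Type*} {Adj : V → V → Prop} (lvl : V → V → ℕ)
    {s u : V} {p : List V} (hp : IsWalk Adj p) (hs : p.head? = some s)
    (hu : p.getLast? = some u) : wdist Adj lvl s u ≤ wscore lvl p :=
  sInf_le ⟨p, hp, hs, hu, rfl⟩

theorem exists_wscore_eq_wdist {V : Type*} {Adj : V → V → Prop} {lvl : V → V → ℕ}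
    {s u : V} (h : wdist Adj lvl s u ≠ ⊤) :
    ∃ p : List V, IsWalk Adj p ∧ p.head? = some s ∧ p.getLast? = some u ∧
      (wscore lvl p : ℕ∞) = wdist Adj lvl s u := by
  have hne : {n : ℕ∞ | ∃ p : List V, IsWalk Adj p ∧ p.head? = some s ∧
      p.getLast? = some u ∧ (wscore lvl p : ℕ∞) = n} ≠ ∅ := fun he =>
    h (by rw [wdist, he, sInf_empty])
  exact csInf_mem (Set.nonempty_iff_ne_empty.mpr hne)

theorem exists_eq_append_pair {V : Type*} {s v : V} (hvs : v ≠ s) {p : List V}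
    (hs : p.head? = some s) (hv : p.getLast? = some v) :
    ∃ (q : List V) (u : V), p = q ++ [u, v] := by
  obtain ⟨r, rfl⟩ := List.getLast?_eq_some_iff.mp hv
  rcases List.eq_nil_or_concat r with rfl | ⟨q, u, rfl⟩
  · simp_all
  · exact ⟨q, u, by simp⟩

theorem wdist_le_of_adj {V : Type*} {Adj : V → V → Prop} (lvl : V → V → ℕ)
    (s : V) {u v : V} (h : Adj u v) :
    wdist Adj lvl s v ≤ max (wdist Adj lvl s u) (lvl u v : ℕ∞) + 1 := by
  by_cases ht : wdist Adj lvl s u = ⊤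
  · simp [ht]
  obtain ⟨p, hp, hs, hu, he⟩ := exists_wscore_eq_wdist ht
  obtain ⟨q, rfl⟩ := List.getLast?_eq_some_iff.mp hu
  have hle := wdist_le_wscore lvl (isWalk_append_pair.mpr ⟨hp, h⟩)
    ((head?_append_pair q u v).trans hs) (by simp : (q ++ [u, v]).getLast? = some v)
  rw [wscore_append_pair] at hle
  rw [← he]
  exact_mod_cast hle

theorem max_wdist_add_one_le_wscore {V : Type*} {Adj : V → V → Prop} (lvl : V → V → ℕ)
    {s u v : V} {q : List V} (hp : IsWalk Adj (q ++ [u, v]))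
    (hs : (q ++ [u, v]).head? = some s) :
    max (wdist Adj lvl s u) (lvl u v : ℕ∞) + 1 ≤ wscore lvl (q ++ [u, v]) := by
  have hle := wdist_le_wscore lvl (isWalk_append_pair.mp hp).1
    ((head?_append_pair q u v).symm.trans hs) (by simp : (q ++ [u]).getLast? = some u)
  rw [wscore_append_pair]
  push_cast
  gcongr
  exact max_le (hle.trans (Nat.cast_le.mpr (le_max_left _ _)))
    (Nat.cast_le.mpr (le_max_right _ _))

/-- Lemma 1 / Bellman equation for the coarse-grained distance: for `v ≠ s`,
`D(s, v)` equals the minimum, over all in-edges `(u, v)`, of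
`max (D(s, u)) (a_{uv}) + 1` (the minimum over an empty set being `∞`).
In particular, a walk `p` from `s` ending with the edge `(u, v)` realizes
`D(s, v)` only if `D(s, v) = max (D(s, u)) (a_{uv}) + 1`, the criterion used
in the recovering phase. -/
theorem stmt12 {V : Type*} (Adj : V → V → Prop) (lvl : V → V → ℕ)
    (s v : V) (hvs : v ≠ s) :
    wdist Adj lvl s v =
      (⨅ u ∈ {u : V | Adj u v}, (max (wdist Adj lvl s u) (lvl u v : ℕ∞) + 1)) ∧
    ∀ (p : List V) (u : V), IsWalk Adj p → p.head? = some s →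
      (∃ q : List V, p = q ++ [u, v]) →
      (wscore lvl p : ℕ∞) = wdist Adj lvl s v →
      wdist Adj lvl s v = max (wdist Adj lvl s u) (lvl u v : ℕ∞) + 1 := by
  refine ⟨le_antisymm (le_iInf₂ fun u hu => wdist_le_of_adj lvl s hu) ?_, ?_⟩
  · refine le_sInf ?_
    rintro _ ⟨p, hp, hs, hv, rfl⟩
    obtain ⟨q, u, rfl⟩ := exists_eq_append_pair hvs hs hv
    exact (iInf₂_le u (isWalk_append_pair.mp hp).2).trans
      (max_wdist_add_one_le_wscore lvl hp hs)
  · rintro _ u hp hs ⟨q, rfl⟩ he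
    exact le_antisymm (wdist_le_of_adj lvl s (isWalk_append_pair.mp hp).2)
      (he ▸ max_wdist_add_one_le_wscore lvl hp hs)
end

section
/- Removing a cycle from a walk does not increase its coarse-grained score: if a walk p from u to v decomposes as p = p₁ · c · p₂ where c is a closed walk (its first and last vertices coincide), then the walk p′ = p₁ · p₂ from u to v satisfies F(p′) ≤ F(p). -/
/-- The score of a walk through `x` is obtained by continuing the fold from the score of the part
ending at `x`, along the edges of the part starting at `x`. -/
theorem wscore_append_cons {V : Type*} (lvl : V → V → ℕ) (q : List V) (x : V) (t : List V) :
    wscore lvl (q ++ x :: t) =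
      (((x :: t).zip t).map (fun e => lvl e.1 e.2)).foldl (fun s a => max s a + 1)
        (wscore lvl (q ++ [x])) := by
  have key : ∀ q : List V, (q ++ x :: t).zip (q ++ x :: t).tail =
      (q ++ [x]).zip (q ++ [x]).tail ++ (x :: t).zip t := by
    intro q
    induction q with
    | nil => simp
    | cons a q ih => cases q <;> simp_all
  simp only [wscore, key, List.map_append, List.foldl_append]

theorem foldl_max_add_one_mono (l : List ℕ) {s s' : ℕ} (h : s ≤ s') :
    l.foldl (fun s a => max s a + 1) s ≤ l.foldl (fun s a => max s a + 1) s' := by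
  induction l generalizing s s' with
  | nil => exact h
  | cons a l ih => exact ih (Nat.add_le_add_right (max_le_max_right a h) 1)

theorem le_foldl_max_add_one (l : List ℕ) (s : ℕ) :
    s ≤ l.foldl (fun s a => max s a + 1) s := by
  induction l generalizing s with
  | nil => exact le_rfl
  | cons a l ih => exact le_trans (by omega) (ih (max s a + 1))

/-- Removing a cycle from a walk does not increase its coarse-grained score:
if `p` decomposes as `p₁ · c · p₂` where `p₁` is a walk from `u` to `x`, `c`
is a closed walk from `x` to `x` and `p₂` is a walk from `x` to `v` (as vertex
lists, the concatenation glues shared endpoints, so `p = p₁ ++ c.tail ++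
p₂.tail` and `p′ = p₁ · p₂ = p₁ ++ p₂.tail`), then `F(p′) ≤ F(p)`. -/
theorem stmt13 {V : Type*} (Adj : V → V → Prop) (lvl : V → V → ℕ)
    (p₁ c p₂ : List V) (u x v : V)
    (h₁ : IsWalk Adj p₁) (hc : IsWalk Adj c) (h₂ : IsWalk Adj p₂)
    (h₁h : p₁.head? = some u) (h₁l : p₁.getLast? = some x)
    (hch : c.head? = some x) (hcl : c.getLast? = some x)
    (h₂h : p₂.head? = some x) (h₂l : p₂.getLast? = some v) :
    wscore lvl (p₁ ++ p₂.tail) ≤ wscore lvl (p₁ ++ c.tail ++ p₂.tail) := by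
  obtain ⟨q, rfl⟩ := List.getLast?_eq_some_iff.mp h₁l
  obtain ⟨d, rfl⟩ := List.getLast?_eq_some_iff.mp hcl
  obtain ⟨r, hr⟩ := List.head?_eq_some_iff.mp hch
  obtain ⟨t, rfl⟩ := List.head?_eq_some_iff.mp h₂h
  have hcycle : q ++ [x] ++ r = q ++ d ++ [x] := by simp [hr]
  have hwalk : q ++ [x] ++ r ++ t = (q ++ d) ++ x :: t := by simp [hcycle]
  rw [hr, List.tail_cons, List.tail_cons, hwalk, List.append_assoc, List.singleton_append,
    wscore_append_cons, wscore_append_cons lvl (q ++ d), ← hcycle, List.append_assoc,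
    List.singleton_append, wscore_append_cons lvl q x r]
  exact foldl_max_add_one_mono _ (le_foldl_max_add_one _ _)
end
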